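/- An R-bLSP morphism f is LSP (a,b,c)-breaking for pairwise distinct letters a, b, c if and only if the longest common prefix of f(b) and f(c) is strictly longer than the longest common prefix of f(a) and f(b). -/

import Mathlib

section LSPDefs

variable {A : Type*} {B : Type*}

/-- `u` is a prefix of the infinite word `w`. -/
def IsPrefixI (u : List A) (w : ℕ → A) : Prop :=
  ∀ (i : ℕ) (h : i < u.length), u.get ⟨i, h⟩ = w i

/-- `u` is a factor of the infinite word `w`. -/
def IsFactorI (u : List A) (w : ℕ → A) : Prop :=
  ∃ k : ℕ, ∀ (i : ℕ) (h : i < u.length), u.get ⟨i, h⟩ = w (k + i)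

/-- `u` is a left special factor of the infinite word `w`. -/
def LeftSpecialI (u : List A) (w : ℕ → A) : Prop :=
  ∃ a b : A, a ≠ b ∧ IsFactorI (a :: u) w ∧ IsFactorI (b :: u) w

/-- An infinite word is LSP if all its left special factors are prefixes of it. -/
def IsLSP (w : ℕ → A) : Prop :=
  ∀ u : List A, LeftSpecialI u w → IsPrefixI u w

/-- Application of a morphism (given by images of letters) to a finite word. -/
def applyM (f : A → List B) (u : List A) : List B := (u.map f).flatten

/-- The prefix of length `n` of an infinite word. -/
def infPrefix (w : ℕ → A) (n : ℕ) : List A := List.ofFn (fun i : Fin n => w i)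

/-- `x` is the image of the infinite word `w` under the morphism `f`. -/
def InfImage (f : A → List B) (w : ℕ → A) (x : ℕ → B) : Prop :=
  ∀ n : ℕ, IsPrefixI (applyM f (infPrefix w n)) x

/-- `f` is a basic LSP (bLSP) endomorphism. -/
def IsBLSP (f : A → List A) : Prop :=
  ∃ α : A, f α = [α] ∧ ∀ β : A, β ≠ α → ∃ γ : A, f β = f γ ++ [β]

/-- `f` is an R-bLSP morphism with domain alphabet `D`: the restriction to `D` of a
bLSP morphism `g` (letters outside the domain are sent to `[]`). -/
def IsRBLSPOn (D : Set A) (f : A → List A) : Prop :=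
  (∀ x : A, x ∈ D ↔ f x ≠ []) ∧ ∃ g : A → List A, IsBLSP g ∧ ∀ x ∈ D, f x = g x

/-- The episturmian morphism `L_α`. -/
def Lmor [DecidableEq A] (α : A) : A → List A := fun β => if β = α then [α] else [α, β]

/-- `u` is an `(a,b,c,β,γ)`-fragility of `w`. -/
def Frag5 (w : ℕ → A) (a b c β γ : A) (u : List A) : Prop :=
  IsPrefixI (u ++ [a]) w ∧ IsFactorI (β :: (u ++ [b])) w ∧ IsFactorI (γ :: (u ++ [c])) w

/-- `w` is `(a,b,c)`-fragile. -/
def Fragile (w : ℕ → A) (a b c : A) : Prop :=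
  ∃ (u : List A) (β γ : A), β ≠ γ ∧ Frag5 w a b c β γ u

/-- `f` is LSP `(a,b,c)`-breaking (for words over the domain `D` of `f`). -/
def Breaking (D : Set A) (f : A → List A) (a b c : A) : Prop :=
  ∀ (w x : ℕ → A), Set.range w ⊆ D → IsLSP w → Fragile w a b c →
    InfImage f w x → ¬ IsLSP x

/-- Length of the longest common prefix of two finite words. -/
noncomputable def lcpLen (u v : List A) : ℕ :=
  sSup {n | n ≤ u.length ∧ n ≤ v.length ∧ u.take n = v.take n}

/-- A morphism is nonerasing if images of letters are nonempty. -/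
def Nonerasing (f : A → List B) : Prop := ∀ a : A, f a ≠ []

/-- `f` preserves the LSP property for infinite words. -/
def PreservesLSP (f : A → List B) : Prop :=
  ∀ (w : ℕ → A) (x : ℕ → B), IsLSP w → InfImage f w x → IsLSP x

/-- `f ∈ U(A,B)`: nonerasing and each letter of `B` occurs at most once in total
among the images of letters. -/
def InU [Fintype A] [DecidableEq B] (f : A → List B) : Prop :=
  Nonerasing f ∧ ∀ b : B, (∑ a : A, (f a).count b) ≤ 1

/-- `u^k`. -/
def listPow (u : List B) (k : ℕ) : List B := (List.replicate k u).flatten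

/-- `x = u^ω`. -/
def IsOmegaPow (u : List B) (x : ℕ → B) : Prop := ∀ k : ℕ, IsPrefixI (listPow u k) x

/-- `f ∈ P_LSP(A,B)`: nonerasing, all images are positive powers of a word `u`
with `u^ω` LSP. -/
def InPLSP (f : A → List B) : Prop :=
  Nonerasing f ∧ ∃ u : List B, u ≠ [] ∧ (∀ a : A, ∃ k : ℕ, 0 < k ∧ f a = listPow u k) ∧
    ∀ x : ℕ → B, IsOmegaPow u x → IsLSP x

/-- `r` is the primitive root of `w`. -/
def IsPrimRoot (r w : List B) : Prop :=
  (∃ k : ℕ, 0 < k ∧ w = listPow r k) ∧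
  ∀ (v : List B) (k : ℕ), 0 < k → w = listPow v k → r.length ≤ v.length

/-- Compatibility of a chain of morphisms `[g_1, …, g_n]` (composition
`g_1 ∘ ⋯ ∘ g_n`): every letter produced by `g_{i+1}` lies in the domain of `g_i`. -/
def CompatChain (L : List (B → List B)) : Prop :=
  List.Chain' (fun g h => ∀ x y, y ∈ h x → g y ≠ []) L

end LSPDefs

theorem lsp_iff {A : Type*} (x : ℕ → A) : IsLSP x ↔ ∀ k l N : ℕ, x k ≠ x l →
    (∀ i < N, x (k + 1 + i) = x (l + 1 + i)) → ∀ i < N, x i = x (k + 1 + i) := by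
  constructor
  · intro h k l N hkl hag i hi
    have hp := h (List.ofFn (fun i : Fin N => x (k + 1 + i))) ⟨x k, x l, hkl, ⟨k, ?_⟩, ⟨l, ?_⟩⟩
    · have := hp i (by simpa using hi)
      simpa using this.symm
    · rintro (_ | i) hi
      · simp
      · simp [Nat.add_assoc, Nat.add_comm 1]
    · rintro (_ | i) hi
      · simp
      · have hi' : i < N := by simpa using hi
        have := hag i hi'
        simp only [List.get_eq_getElem, List.getElem_cons_succ, List.getElem_ofFn]
        rw [this]; congr 1; omega
  · rintro h u ⟨p, q, hpq, ⟨k, hk⟩, ⟨l, hl⟩⟩ i hi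
    have hk0 := hk 0 (by simp)
    have hl0 := hl 0 (by simp)
    simp only [List.get_eq_getElem, List.getElem_cons_zero, Nat.add_zero] at hk0 hl0
    have e1 : ∀ i (hi : i < u.length), u[i] = x (k + 1 + i) := by
      intro i hi
      have := hk (i + 1) (by simpa using hi)
      simp only [List.get_eq_getElem, List.getElem_cons_succ] at this
      rw [this]; congr 1; omega
    have e2 : ∀ i (hi : i < u.length), u[i] = x (l + 1 + i) := by
      intro i hi
      have := hl (i + 1) (by simpa using hi)
      simp only [List.get_eq_getElem, List.getElem_cons_succ] at this
      rw [this]; congr 1; omega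
    have := h k l u.length (by rw [← hk0, ← hl0]; exact hpq)
      (fun i hi => by rw [← e1 i hi, ← e2 i hi]) i hi
    rw [this]; exact e1 i hi

theorem lcp_spec {A : Type*} (u v : List A) : lcpLen u v ≤ u.length ∧ lcpLen u v ≤ v.length ∧
    u.take (lcpLen u v) = v.take (lcpLen u v) ∧
    ∀ n, n ≤ u.length → n ≤ v.length → u.take n = v.take n → n ≤ lcpLen u v := by
  have hb : BddAbove {n | n ≤ u.length ∧ n ≤ v.length ∧ u.take n = v.take n} :=
    ⟨u.length, fun n hn => hn.1⟩
  have hm : lcpLen u v ∈ {n | n ≤ u.length ∧ n ≤ v.length ∧ u.take n = v.take n} :=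
    Nat.sSup_mem ⟨0, by simp⟩ hb
  exact ⟨hm.1, hm.2.1, hm.2.2, fun n h1 h2 h3 => le_csSup hb ⟨h1, h2, h3⟩⟩

theorem lcp_get {A : Type*} (u v : List A) (i : ℕ) (h : i < lcpLen u v) : u[i]? = v[i]? := by
  obtain ⟨_, _, h3, _⟩ := lcp_spec u v
  have := congrArg (fun t : List A => t[i]?) h3
  simpa [List.getElem?_take, h] using this

theorem lcp_ne {A : Type*} (u v : List A) (h1 : lcpLen u v < u.length)
    (h2 : lcpLen u v < v.length) : u[lcpLen u v]? ≠ v[lcpLen u v]? := by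
  intro h
  obtain ⟨_, _, h3, h4⟩ := lcp_spec u v
  have := h4 (lcpLen u v + 1) h1 h2 (by rw [List.take_add_one, List.take_add_one, h3, h])
  omega

theorem lcp_comm {A : Type*} (u v : List A) : lcpLen u v = lcpLen v u := by
  obtain ⟨a1, a2, a3, a4⟩ := lcp_spec u v
  obtain ⟨b1, b2, b3, b4⟩ := lcp_spec v u
  exact le_antisymm (b4 _ a2 a1 a3.symm) (a4 _ b2 b1 b3.symm)

/-- Start position of the n-th block. -/
def SS {A : Type*} (g : A → List A) (w : ℕ → A) (n : ℕ) : ℕ :=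
  ∑ i ∈ Finset.range n, (g (w i)).length

theorem SS_succ {A : Type*} (g : A → List A) (w : ℕ → A) (n : ℕ) :
    SS g w (n + 1) = SS g w n + (g (w n)).length := Finset.sum_range_succ _ _

theorem SS_zero {A : Type*} (g : A → List A) (w : ℕ → A) : SS g w 0 = 0 := by simp [SS]

theorem applyM_succ {A : Type*} (g : A → List A) (w : ℕ → A) (n : ℕ) :
    applyM g (infPrefix w (n + 1)) = applyM g (infPrefix w n) ++ g (w n) := by
  rw [applyM, infPrefix, List.ofFn_succ_last]
  simp [applyM, infPrefix]

theorem applyM_length {A : Type*} (g : A → List A) (w : ℕ → A) (n : ℕ) :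
    (applyM g (infPrefix w n)).length = SS g w n := by
  induction n with
  | zero => simp [applyM, infPrefix, SS]
  | succ n ih => rw [applyM_succ, List.length_append, ih, SS_succ]

theorem infImage_iff {A : Type*} (g : A → List A) (w x : ℕ → A) : InfImage g w x ↔
    ∀ n j, j < (g (w n)).length → (g (w n))[j]? = some (x (SS g w n + j)) := by
  constructor
  · intro h n j hj
    have := h (n + 1) (SS g w n + j) (by rw [applyM_length, SS_succ]; omega)
    rw [← this]
    simp only [List.get_eq_getElem]
    rw [← List.getElem?_eq_getElem, applyM_succ, List.getElem?_append_right (by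
      rw [applyM_length]; omega), applyM_length, Nat.add_sub_cancel_left]
  · intro h n
    induction n with
    | zero => intro i hi; simp [applyM, infPrefix] at hi
    | succ n ih =>
      intro i hi
      have hi' := hi
      rw [applyM_length, SS_succ] at hi'
      have key : (applyM g (infPrefix w (n+1)))[i]? = some (x i) := by
        rw [applyM_succ]
        by_cases hc : i < SS g w n
        · have hc' : i < (applyM g (infPrefix w n)).length := by rw [applyM_length]; exact hc
          rw [List.getElem?_append_left hc', ← ih i hc']
          simp
        · rw [List.getElem?_append_right (by rw [applyM_length]; omega), applyM_length,
            h n _ (by omega)]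
          congr 2; omega
      rw [List.getElem?_eq_getElem hi] at key
      simpa using key

theorem SS_pos {A : Type*} (g : A → List A) (w : ℕ → A) (hg : ∀ y, 0 < (g y).length) (i : ℕ) :
    ∃ n j, j < (g (w n)).length ∧ i = SS g w n + j := by
  induction i with
  | zero => exact ⟨0, 0, hg _, by simp [SS]⟩
  | succ i ih =>
    obtain ⟨n, j, hj, rfl⟩ := ih
    by_cases h : j + 1 < (g (w n)).length
    · exact ⟨n, j + 1, h, by omega⟩
    · exact ⟨n + 1, 0, hg _, by rw [SS_succ]; omega⟩

theorem SS_lt {A : Type*} (g : A → List A) (w : ℕ → A) {n m i j : ℕ} (hmn : m ≤ n)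
    (h : SS g w n + i = j) (hj : j < SS g w m) : False := by
  have : SS g w m ≤ SS g w n := Finset.sum_le_sum_of_subset (Finset.range_mono hmn)
  omega

theorem infImage_exists {A : Type*} (g : A → List A) (w : ℕ → A) (hg : ∀ y, 0 < (g y).length) :
    ∃ x, InfImage g w x := by
  have hS := SS_pos g w hg
  choose N J hJ hNJ using hS
  refine ⟨fun i => (g (w (N i)))[J i]'(hJ i), (infImage_iff _ _ _).2 ?_⟩
  intro n j hj
  have e := hNJ (SS g w n + j)
  have hJ' := hJ (SS g w n + j)
  have hN : N (SS g w n + j) = n := by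
    rcases lt_trichotomy (N (SS g w n + j)) n with h | h | h
    · exact (SS_lt g w (i := j) h rfl (by rw [SS_succ]; omega)).elim
    · exact h
    · exact (SS_lt g w h e.symm (by rw [SS_succ]; omega)).elim
  have hJe : J (SS g w n + j) = j := by rw [hN] at e; omega
  rw [← List.getElem?_eq_getElem, hN, hJe]

theorem g_last {A : Type*} {g : A → List A} {α : A} (h0 : g α = [α])
    (h1 : ∀ β : A, β ≠ α → ∃ γ : A, g β = g γ ++ [β]) (y : A) : ∃ t, g y = t ++ [y] := by
  by_cases h : y = α
  · subst h; exact ⟨[], by simpa using h0⟩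
  · obtain ⟨γ, hγ⟩ := h1 y h; exact ⟨_, hγ⟩

theorem g_pos {A : Type*} {g : A → List A} {α : A} (h0 : g α = [α])
    (h1 : ∀ β : A, β ≠ α → ∃ γ : A, g β = g γ ++ [β]) (y : A) : 0 < (g y).length := by
  obtain ⟨t, ht⟩ := g_last h0 h1 y
  rw [ht]; simp

theorem g_lastget {A : Type*} {g : A → List A} {α : A} (h0 : g α = [α])
    (h1 : ∀ β : A, β ≠ α → ∃ γ : A, g β = g γ ++ [β]) (y : A) : (g y)[(g y).length - 1]? = some y := by
  obtain ⟨t, ht⟩ := g_last h0 h1 y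
  rw [ht]; simp

theorem g_take {A : Type*} {g : A → List A} {α : A} (h0 : g α = [α])
    (h1 : ∀ β : A, β ≠ α → ∃ γ : A, g β = g γ ++ [β]) (n : ℕ) : ∀ (y : A), (g y).length = n → ∀ (i : ℕ) (δ : A),
    (g y)[i]? = some δ → g δ = (g y).take (i + 1) := by
  induction n using Nat.strong_induction_on with
  | _ n ih =>
    intro y hn i δ hi
    have hlt : i < (g y).length := (List.getElem?_eq_some_iff.1 hi).1
    by_cases hl : i = (g y).length - 1
    · have := g_lastget h0 h1 y
      rw [← hl, hi] at this
      obtain rfl : δ = y := by simpa using this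
      rw [List.take_of_length_le (by omega)]
    · have hy : y ≠ α := by
        rintro rfl
        rw [h0] at hlt hl; simp at hlt hl; omega
      obtain ⟨γ, hγ⟩ := h1 y hy
      have hlen : (g y).length = (g γ).length + 1 := by rw [hγ]; simp
      have hlt' : i < (g γ).length := by omega
      have := ih (g γ).length (by omega) γ rfl i δ (by
        rw [← hi, hγ, List.getElem?_append_left hlt'])
      rw [this, hγ, List.take_append_of_le_length (by omega)]

theorem g_head {A : Type*} {g : A → List A} {α : A} (h0 : g α = [α])
    (h1 : ∀ β : A, β ≠ α → ∃ γ : A, g β = g γ ++ [β]) (y : A) : (g y)[0]? = some α := by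
  have hp := g_pos h0 h1 y
  have e := List.getElem?_eq_getElem hp
  have ht := g_take h0 h1 _ y rfl 0 _ e
  by_cases hd : (g y)[0] = α
  · rw [e, hd]
  · obtain ⟨γ, hγ⟩ := h1 _ hd
    have hq := g_pos h0 h1 γ
    have : (g (g y)[0]).length = (g γ).length + 1 := by
      conv_lhs => rw [hγ]
      simp
    rw [ht] at this
    simp at this
    omega

theorem g_nohead {A : Type*} {g : A → List A} {α : A} (h0 : g α = [α])
    (h1 : ∀ β : A, β ≠ α → ∃ γ : A, g β = g γ ++ [β]) (y : A) (i : ℕ) (hi : (g y)[i]? = some α) : i = 0 := by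
  have hlt : i < (g y).length := (List.getElem?_eq_some_iff.1 hi).1
  have ht := g_take h0 h1 _ y rfl i _ hi
  have := congrArg List.length ht
  rw [h0] at this
  simp at this
  omega

theorem g_same {A : Type*} {g : A → List A} {α : A} (h0 : g α = [α])
    (h1 : ∀ β : A, β ≠ α → ∃ γ : A, g β = g γ ++ [β]) (y z δ : A) (i j : ℕ) (hi : (g y)[i]? = some δ) (hj : (g z)[j]? = some δ) :
    i = j ∧ (g y).take (i + 1) = (g z).take (i + 1) := by
  have hlt : i < (g y).length := (List.getElem?_eq_some_iff.1 hi).1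
  have hlt' : j < (g z).length := (List.getElem?_eq_some_iff.1 hj).1
  have ht := g_take h0 h1 _ y rfl i _ hi
  have ht' := g_take h0 h1 _ z rfl j _ hj
  have e := ht.symm.trans ht'
  have := congrArg List.length e
  simp at this
  have hij : i = j := by omega
  subst hij
  exact ⟨rfl, e⟩

theorem x_ne {A : Type*} {g : A → List A} {α : A} (h0 : g α = [α])
    (h1 : ∀ β : A, β ≠ α → ∃ γ : A, g β = g γ ++ [β]) (w x : ℕ → A) (hx : InfImage g w x) (n n' : ℕ) (hne : w n ≠ w n') :
    x (SS g w n + lcpLen (g (w n)) (g (w n'))) ≠ x (SS g w n' + lcpLen (g (w n)) (g (w n'))) := by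
  rw [infImage_iff] at hx
  have hm : 1 ≤ lcpLen (g (w n)) (g (w n')) := by
    apply (lcp_spec _ _).2.2.2 1 (g_pos h0 h1 _) (g_pos h0 h1 _)
    have e1 := g_head h0 h1 (w n)
    have e2 := g_head h0 h1 (w n')
    rw [List.take_add_one, List.take_add_one, e1, e2]
    simp
  have hal : ∀ n, x (SS g w n) = α := by
    intro n
    have := hx n 0 (g_pos h0 h1 _)
    rw [g_head h0 h1] at this
    simpa using this.symm
  obtain ⟨l1, l2, l3, -⟩ := lcp_spec (g (w n)) (g (w n'))
  have hN := lcp_ne (g (w n)) (g (w n'))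
  generalize lcpLen (g (w n)) (g (w n')) = m at *
  intro he
  rcases Nat.lt_or_ge m (g (w n)).length with c1 | c1 <;>
    rcases Nat.lt_or_ge m (g (w n')).length with c2 | c2
  · apply hN c1 c2
    rw [hx n m c1, hx n' m c2, he]
  · have e : SS g w n' + m = SS g w (n' + 1) := by rw [SS_succ]; omega
    rw [e, hal] at he
    have := g_nohead h0 h1 (w n) m (by rw [hx n m c1, he])
    omega
  · have e : SS g w n + m = SS g w (n + 1) := by rw [SS_succ]; omega
    rw [e, hal] at he
    have := g_nohead h0 h1 (w n') m (by rw [hx n' m c2, he])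
    omega
  · rw [List.take_of_length_le c1, List.take_of_length_le c2] at l3
    have e1 := g_lastget h0 h1 (w n)
    rw [l3, g_lastget h0 h1 (w n')] at e1
    exact hne (by simpa using e1.symm)

theorem x_last {A : Type*} {g : A → List A} {α : A} (h0 : g α = [α])
    (h1 : ∀ β : A, β ≠ α → ∃ γ : A, g β = g γ ++ [β]) (w x : ℕ → A) (hx : InfImage g w x) (n k : ℕ) (hk : k + 1 = SS g w (n + 1)) :
    x k = w n := by
  rw [infImage_iff] at hx
  have hp := g_pos h0 h1 (w n)
  rw [SS_succ] at hk
  have := hx n ((g (w n)).length - 1) (by omega)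
  rw [g_lastget h0 h1] at this
  have e : k = SS g w n + ((g (w n)).length - 1) := by omega
  rw [e]; simpa using this.symm

theorem SS_shift {A : Type*} (g : A → List A) (w : ℕ → A) (k m : ℕ)
    (h : ∀ i < m, w (k + i) = w i) : SS g w (k + m) = SS g w k + SS g w m := by
  rw [SS, Finset.sum_range_add]
  congr 1
  exact Finset.sum_congr rfl fun i hi => by rw [h i (Finset.mem_range.1 hi)]

theorem x_shift {A : Type*} {g : A → List A} {α : A} (h0 : g α = [α])
    (h1 : ∀ β : A, β ≠ α → ∃ γ : A, g β = g γ ++ [β]) (w x : ℕ → A) (hx : InfImage g w x) (k m : ℕ)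
    (h : ∀ i < m, w (k + i) = w i) (i : ℕ) (hi : i < SS g w m) : x (SS g w k + i) = x i := by
  rw [infImage_iff] at hx
  obtain ⟨n, j, hj, rfl⟩ := SS_pos g w (g_pos h0 h1) i
  have hn : n < m := by
    by_contra hc
    exact SS_lt g w (by omega) rfl hi
  have e1 := hx n j hj
  have e2 := hx (k + n) j (by rw [h n hn]; exact hj)
  rw [h n hn, e1, SS_shift g w k n (fun i hi => h i (by omega))] at e2
  rw [← Nat.add_assoc]
  simpa using e2.symm

theorem breaking_of_lt {A : Type*} {g : A → List A} {α : A} (h0 : g α = [α])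
    (h1 : ∀ β : A, β ≠ α → ∃ γ : A, g β = g γ ++ [β]) (a b c : A) (hab : a ≠ b)
    (hlt : lcpLen (g a) (g b) < lcpLen (g b) (g c)) (w x : ℕ → A) (hfr : Fragile w a b c)
    (hx : InfImage g w x) : ¬ IsLSP x := by
  intro hL
  rw [lsp_iff] at hL
  obtain ⟨u, β, γ, hβγ, hp, ⟨k, hk⟩, ⟨l, hl⟩⟩ := hfr
  have pa : w u.length = a := by
    have := hp u.length (by simp)
    simpa using this.symm
  have pu : ∀ i (hi : i < u.length), w i = u[i] := by
    intro i hi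
    have := hp i (by simp; omega)
    simpa [List.getElem_append_left, hi] using this.symm
  have fac : ∀ (k : ℕ) (β b : A), (∀ (i : ℕ) (h : i < (β :: (u ++ [b])).length),
      (β :: (u ++ [b])).get ⟨i, h⟩ = w (k + i)) → w k = β ∧ w (k + 1 + u.length) = b ∧
      ∀ i < u.length, w (k + 1 + i) = w i := by
    intro k β b hk
    refine ⟨?_, ?_, ?_⟩
    · simpa using (hk 0 (by simp)).symm
    · have := hk (u.length + 1) (by simp)
      rw [Nat.add_assoc, Nat.add_comm 1]
      simpa using this.symm
    · intro i hi
      have := hk (i + 1) (by simp; omega)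
      rw [pu i hi, Nat.add_assoc, Nat.add_comm 1]
      simpa [List.getElem_append_left, hi] using this.symm
  obtain ⟨k1, k2, k3⟩ := fac k β b hk
  obtain ⟨l1, l2, l3⟩ := fac l γ c hl
  obtain ⟨K, hK⟩ : ∃ K, K + 1 = SS g w (k + 1) :=
    ⟨SS g w (k + 1) - 1, by rw [SS_succ]; have := g_pos h0 h1 (w k); omega⟩
  obtain ⟨L, hLL⟩ : ∃ L, L + 1 = SS g w (l + 1) :=
    ⟨SS g w (l + 1) - 1, by rw [SS_succ]; have := g_pos h0 h1 (w l); omega⟩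
  have xK := x_last h0 h1 w x hx k K hK
  have xL := x_last h0 h1 w x hx l L hLL
  have sk := SS_shift g w (k + 1) u.length k3
  have sl := SS_shift g w (l + 1) u.length l3
  have hB := (infImage_iff g w x).1 hx
  obtain ⟨q1, q2, -, -⟩ := lcp_spec (g b) (g c)
  have key := hL K L (SS g w u.length + lcpLen (g b) (g c)) (by rw [xK, xL, k1, l1]; exact hβγ) ?_
    (SS g w u.length + lcpLen (g a) (g b)) (by omega)
  · have := x_ne h0 h1 w x hx u.length (k + 1 + u.length) (by rw [pa, k2]; exact hab)
    rw [pa, k2, sk] at this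
    apply this
    rw [key, hK, Nat.add_assoc]
  · intro i hi
    rw [hK, hLL]
    by_cases hc : i < SS g w u.length
    · rw [x_shift h0 h1 w x hx _ _ k3 i hc, x_shift h0 h1 w x hx _ _ l3 i hc]
    · obtain ⟨j, rfl⟩ := Nat.exists_eq_add_of_le (Nat.le_of_not_lt hc)
      have hj : j < lcpLen (g b) (g c) := by omega
      have e1 := hB (k + 1 + u.length) j (by rw [k2]; omega)
      have e2 := hB (l + 1 + u.length) j (by rw [l2]; omega)
      rw [k2, sk] at e1
      rw [l2, sl] at e2
      rw [lcp_get _ _ j hj, e2] at e1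
      rw [← Nat.add_assoc, ← Nat.add_assoc]
      simpa using e1.symm

/-- The periodic word abcabc... -/
def abcWord {A : Type*} (a b c : A) (n : ℕ) : A :=
  if n % 3 = 0 then a else if n % 3 = 1 then b else c

theorem abc_inj {A : Type*} (a b c : A) (hab : a ≠ b) (hbc : b ≠ c) (hac : a ≠ c) (n m : ℕ) :
    abcWord a b c n = abcWord a b c m ↔ n % 3 = m % 3 := by
  have h1 : n % 3 < 3 := Nat.mod_lt _ (by omega)
  have h2 : m % 3 < 3 := Nat.mod_lt _ (by omega)
  unfold abcWord
  constructor
  · intro h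
    split_ifs at h <;> first | omega | (exfalso; grind)
  · intro h; rw [h]

theorem abc_lsp {A : Type*} (a b c : A) (hab : a ≠ b) (hbc : b ≠ c) (hac : a ≠ c) :
    IsLSP (abcWord a b c) := by
  rw [lsp_iff]
  intro k l N hne hag i hi
  have := hag 0 (by omega)
  rw [abc_inj a b c hab hbc hac] at this
  exact (hne ((abc_inj a b c hab hbc hac _ _).2 (by omega))).elim

theorem abc_fragile {A : Type*} (a b c : A) (hab : a ≠ b) : Fragile (abcWord a b c) a b c := by
  refine ⟨[], a, b, hab, ?_, ⟨0, ?_⟩, ⟨1, ?_⟩⟩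
  · intro i hi
    have : i = 0 := by simpa using hi
    subst this; simp [abcWord]
  · intro i hi
    have : i < 2 := by simpa using hi
    interval_cases i <;> simp [abcWord]
  · intro i hi
    have : i < 2 := by simpa using hi
    interval_cases i <;> simp [abcWord]

theorem abc_image_lsp {A : Type*} {g : A → List A} {α : A} (h0 : g α = [α])
    (h1 : ∀ β : A, β ≠ α → ∃ γ : A, g β = g γ ++ [β]) (a b c : A) (hab : a ≠ b) (hbc : b ≠ c) (hac : a ≠ c)
    (hle : lcpLen (g b) (g c) ≤ lcpLen (g a) (g b)) (x : ℕ → A)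
    (hx : InfImage g (abcWord a b c) x) : IsLSP x := by
  rw [lsp_iff]
  intro k l N hne hag i hi
  have hB := (infImage_iff _ _ _).1 hx
  have hinj := abc_inj a b c hab hbc hac
  have h3 : ∀ n, abcWord a b c n = a ∨ abcWord a b c n = b ∨ abcWord a b c n = c := by
    intro n; unfold abcWord; split_ifs <;> simp
  have hw0 : abcWord a b c 0 = a := by simp [abcWord]
  generalize abcWord a b c = w at *
  obtain ⟨n, j, hj, hkn⟩ := SS_pos g w (g_pos h0 h1) (k + 1)
  obtain ⟨n', j', hj', hln⟩ := SS_pos g w (g_pos h0 h1) (l + 1)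
  have a0 := hag 0 (by omega)
  simp only [Nat.add_zero] at a0
  have e1 := hB n j hj
  have e2 := hB n' j' hj'
  rw [← hkn] at e1
  rw [← hln, ← a0] at e2
  obtain ⟨hjj, ht⟩ := g_same h0 h1 _ _ _ _ _ e1 e2
  subst hjj
  rcases j with _ | j
  swap
  · exfalso
    apply hne
    have f1 := hB n j (by omega)
    have f2 := hB n' j (by omega)
    have : (g (w n))[j]? = (g (w n'))[j]? := by
      have := congrArg (fun t : List A => t[j]?) ht
      have hh : j < j + 1 + 1 := by omega
      simpa [List.getElem?_take, hh] using this
    rw [f1, f2] at this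
    have k' : k = SS g w n + j := by omega
    have l' : l = SS g w n' + j := by omega
    rw [k', l']; simpa using this
  replace hkn : k + 1 = SS g w n := hkn
  replace hln : l + 1 = SS g w n' := hln
  rcases n with _ | n
  · rw [SS_zero] at hkn; omega
  rcases n' with _ | n'
  · rw [SS_zero] at hln; omega
  rw [x_last h0 h1 w x hx n k hkn, x_last h0 h1 w x hx n' l hln] at hne
  have hne' : w (n + 1) ≠ w (n' + 1) := by
    rw [Ne, hinj] at hne ⊢; omega
  rw [hkn, hln] at hag
  rw [hkn]
  have hN : N ≤ lcpLen (g (w (n + 1))) (g (w (n' + 1))) := by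
    by_contra hc
    exact x_ne h0 h1 w x hx _ _ hne' (hag _ (by omega))
  have hB0 := fun i => hB 0 i
  simp only [SS_zero, Nat.zero_add, hw0] at hB0
  have hai := hag i hi
  obtain ⟨q1, q2, -, -⟩ := lcp_spec (g (w (n + 1))) (g (w (n' + 1)))
  have r1 := hB (n + 1) i (by omega)
  have r2 := hB (n' + 1) i (by omega)
  rw [← hai] at r2
  have fin : ∀ y, (g y)[i]? = some (x (SS g w (n + 1) + i)) → i < lcpLen (g a) (g y) ∨ y = a →
      x i = x (SS g w (n + 1) + i) := by
    intro y hy hor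
    have hlt : i < (g y).length := (List.getElem?_eq_some_iff.1 hy).1
    have ha : (g a)[i]? = some (x (SS g w (n + 1) + i)) := by
      rcases hor with h | rfl
      · rw [lcp_get _ _ _ h, hy]
      · exact hy
    have hlt : i < (g a).length := (List.getElem?_eq_some_iff.1 ha).1
    rw [hB0 i hlt] at ha
    simpa using ha
  have hcomm := lcp_comm (g b) (g c)
  rcases h3 (n + 1) with h | h | h
  · exact fin _ r1 (Or.inr h)
  · rcases h3 (n' + 1) with h' | h' | h'
    · exact fin _ r2 (Or.inr h')
    · exact (hne' (h.trans h'.symm)).elim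
    · refine fin _ r1 (Or.inl ?_)
      rw [h, h'] at hN; rw [h]; omega
  · rcases h3 (n' + 1) with h' | h' | h'
    · exact fin _ r2 (Or.inr h')
    · refine fin _ r2 (Or.inl ?_)
      rw [h, h'] at hN; rw [h']; omega
    · exact (hne' (h.trans h'.symm)).elim

theorem infImage_congr {A : Type*} (f g : A → List A) (w x : ℕ → A) (h : ∀ n, f (w n) = g (w n)) :
    InfImage f w x ↔ InfImage g w x := by
  have : ∀ n, applyM f (infPrefix w n) = applyM g (infPrefix w n) := by
    intro n
    induction n with
    | zero => rfl
    | succ n ih => rw [applyM_succ, applyM_succ, ih, h]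
  simp only [InfImage, this]

/-- an R-bLSP morphism is LSP `(a,b,c)`-breaking iff the longest
common prefix of `f(b)` and `f(c)` is strictly longer than the one of `f(a)` and
`f(b)`. -/
theorem breaking_iff_lcp {A : Type*} (D : Set A) (f : A → List A)
    (hf : IsRBLSPOn D f) (a b c : A) (ha : a ∈ D) (hb : b ∈ D) (hc : c ∈ D)
    (hab : a ≠ b) (hbc : b ≠ c) (hac : a ≠ c) :
    Breaking D f a b c ↔ lcpLen (f a) (f b) < lcpLen (f b) (f c) := by
  obtain ⟨-, g, ⟨α, h0, h1⟩, hfg⟩ := hf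
  rw [hfg a ha, hfg b hb, hfg c hc]
  constructor
  · intro hbr
    by_contra hc'
    obtain ⟨x, hx⟩ := infImage_exists g (abcWord a b c) (g_pos h0 h1)
    have hD : ∀ n, abcWord a b c n ∈ D := by
      intro n; unfold abcWord; split_ifs <;> assumption
    exact hbr (abcWord a b c) x (by rintro _ ⟨n, rfl⟩; exact hD n)
      (abc_lsp a b c hab hbc hac) (abc_fragile a b c hab)
      ((infImage_congr f g _ x fun n => hfg _ (hD n)).2 hx)
      (abc_image_lsp h0 h1 a b c hab hbc hac (by omega) x hx)
  · intro hlt w x hw _ hfr hx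
    exact breaking_of_lt h0 h1 a b c hab hlt w x hfr
      ((infImage_congr f g w x fun n => hfg _ (hw ⟨n, rfl⟩)).1 hx)
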